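/- For d ≥ 2, κ_i > −1 (i = 1,…,d+1), n ∈ ℕ_0 and every polynomial f in d variables of degree at most n, one has Σ_{i=1}^d ‖ √(x_i(1−|x|)) ∂_i f ‖_{κ,2}² + Σ_{1≤i<j≤d} ‖ √(x_i x_j) ∂_{i,j} f ‖_{κ,2}² ≤ n(n+|κ|+d) ‖f‖_{κ,2}². -/

import Mathlib

open MeasureTheory Finset

noncomputable section

/-- The simplex `△^d = {x : x_i ≥ 0, x_1 + ⋯ + x_d ≤ 1}`. -/
def Splx (d : ℕ) : Set (Fin d → ℝ) := {x | (∀ i, 0 ≤ x i) ∧ ∑ i, x i ≤ 1}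

/-- The `i`-th partial derivative. -/
def pd {d : ℕ} (i : Fin d) (f : (Fin d → ℝ) → ℝ) : (Fin d → ℝ) → ℝ :=
  fun x => fderiv ℝ f x (Pi.single i 1)

/-- `∂_{i,j} = ∂_i - ∂_j`. -/
def pdd {d : ℕ} (i j : Fin d) (f : (Fin d → ℝ) → ℝ) : (Fin d → ℝ) → ℝ :=
  fun x => pd i f x - pd j f x

/-- `⟨x,∇⟩ = ∑ x_i ∂_i`. -/
def xgrad {d : ℕ} (f : (Fin d → ℝ) → ℝ) : (Fin d → ℝ) → ℝ :=
  fun x => ∑ i, x i * pd i f x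

/-- The Jacobi weight `W_κ(x) = x_1^{κ_1} ⋯ x_d^{κ_d} (1-|x|)^{κ_{d+1}}`. -/
def Wk {d : ℕ} (κ : Fin (d+1) → ℝ) (x : Fin d → ℝ) : ℝ :=
  (∏ i : Fin d, x i ^ κ i.castSucc) * (1 - ∑ i, x i) ^ κ (Fin.last d)

/-- The spectral operator `D_κ`. -/
def Dk {d : ℕ} (κ : Fin (d+1) → ℝ) (f : (Fin d → ℝ) → ℝ) (x : Fin d → ℝ) : ℝ :=
  (∑ i, x i * (1 - x i) * pd i (pd i f) x)
    - 2 * ∑ i, ∑ j ∈ Finset.univ.filter (fun j => i < j), x i * x j * pd i (pd j f) x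
    + ∑ i, (κ i.castSucc + 1 - ((∑ k, κ k) + (d : ℝ) + 1) * x i) * pd i f x

/-- The normalizing constant `b_κ`. -/
def bk {d : ℕ} (κ : Fin (d+1) → ℝ) : ℝ :=
  Real.Gamma ((∑ i, κ i) + (d : ℝ) + 1) / ∏ i, Real.Gamma (κ i + 1)

/-- The inner product `⟨f,g⟩_κ = b_κ ∫_{△^d} f g W_κ`. -/
def ipk {d : ℕ} (κ : Fin (d+1) → ℝ) (f g : (Fin d → ℝ) → ℝ) : ℝ :=
  bk κ * ∫ x in Splx d, f x * g x * Wk κ x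

/-- The norm `‖f‖_{κ,2}`. -/
def nrm2 {d : ℕ} (κ : Fin (d+1) → ℝ) (f : (Fin d → ℝ) → ℝ) : ℝ :=
  Real.sqrt (ipk κ f f)

/-- Membership in `V_n^d(W_κ)`: a polynomial of degree (at most) `n` orthogonal to all
polynomials of lower degree. -/
def InVn (d n : ℕ) (κ : Fin (d+1) → ℝ) (f : MvPolynomial (Fin d) ℝ) : Prop :=
  f.totalDegree ≤ n ∧ ∀ g : MvPolynomial (Fin d) ℝ, g.totalDegree < n →
    ipk κ (fun x => MvPolynomial.eval x f) (fun x => MvPolynomial.eval x g) = 0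

/-- `x_k` for `1 ≤ k ≤ d+1`, with the convention `x_{d+1} = 1 - |x|`. -/
def xe {d : ℕ} (x : Fin d → ℝ) (k : Fin (d+1)) : ℝ :=
  if h : (k : ℕ) < d then x ⟨(k : ℕ), h⟩ else 1 - ∑ i, x i

/-- The quantity `Σ_i ‖√(x_i(1-|x|)) ∂_i f‖²_{κ,2} + Σ_{i<j} ‖√(x_i x_j) ∂_{i,j} f‖²_{κ,2}`. -/
def bform {d : ℕ} (κ : Fin (d+1) → ℝ) (F : (Fin d → ℝ) → ℝ) : ℝ :=
  (∑ i, nrm2 κ (fun x => Real.sqrt (x i * (1 - ∑ k, x k)) * pd i F x) ^ 2) +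
  ∑ i, ∑ j ∈ Finset.univ.filter (fun j => i < j),
    nrm2 κ (fun x => Real.sqrt (x i * x j) * pdd i j F x) ^ 2

/-- The Euler operator `∑ x_i ∂_i` on polynomials. -/
def eulerOp (d : ℕ) : Derivation ℝ (MvPolynomial (Fin d) ℝ) (MvPolynomial (Fin d) ℝ) :=
  ∑ i, (MvPolynomial.X i : MvPolynomial (Fin d) ℝ) • MvPolynomial.pderiv i

theorem eulerOp_apply {d : ℕ} (p : MvPolynomial (Fin d) ℝ) :
    eulerOp d p = ∑ i, MvPolynomial.X i * MvPolynomial.pderiv i p := by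
  have h : ∀ s : Finset (Fin d),
      (∑ i ∈ s, (MvPolynomial.X i : MvPolynomial (Fin d) ℝ) • MvPolynomial.pderiv (R := ℝ) i) p
        = ∑ i ∈ s, MvPolynomial.X i * MvPolynomial.pderiv i p := by
    intro s
    induction s using Finset.induction_on with
    | empty => simp
    | insert a s ha ih => simp [Finset.sum_insert ha, ih]
  exact h _

theorem eulerOp_monomial {d : ℕ} (α : Fin d →₀ ℕ) (c : ℝ) :
    eulerOp d (MvPolynomial.monomial α c) = (α.degree : ℝ) • MvPolynomial.monomial α c := by
  rw [eulerOp_apply, (MvPolynomial.isHomogeneous_monomial c rfl).sum_X_mul_pderiv,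
    Nat.cast_smul_eq_nsmul]

/-- The operator `-D_κ` on polynomials, with `a_i = κ_i + 1` and `s = |κ| + d + 1`. -/
def jacobiOp {d : ℕ} (a : Fin d → ℝ) (s : ℝ) (p : MvPolynomial (Fin d) ℝ) :
    MvPolynomial (Fin d) ℝ :=
  eulerOp d (eulerOp d p) + (s - 1) • eulerOp d p -
    ∑ i, (MvPolynomial.X i * MvPolynomial.pderiv i (MvPolynomial.pderiv i p) +
      a i • MvPolynomial.pderiv i p)

theorem jacobiOp_add {d : ℕ} (a : Fin d → ℝ) (s : ℝ) (p q : MvPolynomial (Fin d) ℝ) :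
    jacobiOp a s (p + q) = jacobiOp a s p + jacobiOp a s q := by
  simp only [jacobiOp, map_add, smul_add, mul_add, Finset.sum_add_distrib]
  ring

theorem jacobiOp_smul {d : ℕ} (a : Fin d → ℝ) (s c : ℝ) (p : MvPolynomial (Fin d) ℝ) :
    jacobiOp a s (c • p) = c • jacobiOp a s p := by
  simp only [jacobiOp, Derivation.map_smul, mul_smul_comm, smul_sub, smul_add, Finset.smul_sum,
    smul_comm _ c]

theorem jacobiOp_monomial_sub_mem {d : ℕ} (a : Fin d → ℝ) (s : ℝ) {n : ℕ} (α : Fin d →₀ ℕ)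
    (h : α.degree ≤ n + 1) :
    jacobiOp a s (MvPolynomial.monomial α 1)
        - ((α.degree : ℝ) * (α.degree + s - 1)) • MvPolynomial.monomial α 1
      ∈ MvPolynomial.restrictTotalDegree (Fin d) ℝ n := by
  have hd : ∀ i, MvPolynomial.pderiv i (MvPolynomial.monomial α (1 : ℝ))
      ∈ MvPolynomial.restrictTotalDegree (Fin d) ℝ n := by
    intro i
    rw [MvPolynomial.mem_restrictTotalDegree]
    have := ((MvPolynomial.isHomogeneous_monomial (1 : ℝ) (rfl : α.degree = α.degree)).pderiv
      (i := i)).totalDegree_le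
    omega
  have hx : ∀ i, (MvPolynomial.X i : MvPolynomial (Fin d) ℝ) * MvPolynomial.pderiv i
      (MvPolynomial.pderiv i (MvPolynomial.monomial α (1 : ℝ)))
      ∈ MvPolynomial.restrictTotalDegree (Fin d) ℝ n := by
    intro i
    have e := MvPolynomial.pderiv_monomial (R := ℝ) (s := α) (a := 1) (i := i)
    rw [e, MvPolynomial.X_mul_pderiv_monomial, ← e]
    exact Submodule.smul_of_tower_mem _ _ (hd i)
  have e : jacobiOp a s (MvPolynomial.monomial α 1)
        - ((α.degree : ℝ) * (α.degree + s - 1)) • MvPolynomial.monomial α 1 =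
      - ∑ i, (MvPolynomial.X i * MvPolynomial.pderiv i
          (MvPolynomial.pderiv i (MvPolynomial.monomial α (1 : ℝ))) +
        a i • MvPolynomial.pderiv i (MvPolynomial.monomial α (1 : ℝ))) := by
    rw [jacobiOp, eulerOp_monomial, Derivation.map_smul, eulerOp_monomial]
    module
  rw [e]
  exact Submodule.neg_mem _ (Submodule.sum_mem _ fun i _ =>
    Submodule.add_mem _ (hx i) (Submodule.smul_mem _ _ (hd i)))

theorem restrictTotalDegree_induction {d n : ℕ} {P : MvPolynomial (Fin d) ℝ → Prop}
    (h1 : ∀ α : Fin d →₀ ℕ, α.degree ≤ n → P (MvPolynomial.monomial α 1)) (h0 : P 0)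
    (hadd : ∀ p q, P p → P q → P (p + q)) (hsmul : ∀ (c : ℝ) p, P p → P (c • p))
    {p : MvPolynomial (Fin d) ℝ} (hp : p ∈ MvPolynomial.restrictTotalDegree (Fin d) ℝ n) :
    P p := by
  rw [MvPolynomial.restrictTotalDegree, MvPolynomial.restrictSupport_eq_span] at hp
  induction hp using Submodule.span_induction with
  | mem x hx => obtain ⟨α, hα, rfl⟩ := hx; exact h1 α hα
  | zero => exact h0
  | add x y _ _ hx hy => exact hadd _ _ hx hy
  | smul c x _ hx => exact hsmul _ _ hx

theorem jacobiOp_mem {d : ℕ} (a : Fin d → ℝ) (s : ℝ) {n : ℕ} {p : MvPolynomial (Fin d) ℝ}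
    (hp : p ∈ MvPolynomial.restrictTotalDegree (Fin d) ℝ n) :
    jacobiOp a s p ∈ MvPolynomial.restrictTotalDegree (Fin d) ℝ n := by
  refine restrictTotalDegree_induction (P := fun p =>
      jacobiOp a s p ∈ MvPolynomial.restrictTotalDegree (Fin d) ℝ n)
    (fun α hα => ?_) ?_ (fun p q hp hq => ?_) (fun c p hp => ?_) hp
  · have h1 := jacobiOp_monomial_sub_mem a s α (hα.trans n.le_succ)
    have h2 : (MvPolynomial.monomial α (1 : ℝ)) ∈ MvPolynomial.restrictTotalDegree (Fin d) ℝ n :=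
      (MvPolynomial.mem_restrictTotalDegree _ _ _).2
        ((MvPolynomial.isHomogeneous_monomial (1 : ℝ) rfl).totalDegree_le.trans hα)
    have h := Submodule.add_mem _ h1
      (Submodule.smul_mem _ ((α.degree : ℝ) * (α.degree + s - 1)) h2)
    rwa [sub_add_cancel] at h
  · simp [jacobiOp]
  · rw [jacobiOp_add]; exact Submodule.add_mem _ hp hq
  · rw [jacobiOp_smul]; exact Submodule.smul_mem _ _ hp

theorem jacobiOp_sub_mem {d : ℕ} (a : Fin d → ℝ) (s : ℝ) {n : ℕ} {p : MvPolynomial (Fin d) ℝ}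
    (hp : p ∈ MvPolynomial.restrictTotalDegree (Fin d) ℝ (n + 1)) :
    jacobiOp a s p - (((n + 1 : ℕ) : ℝ) * ((n + 1 : ℕ) + s - 1)) • p
      ∈ MvPolynomial.restrictTotalDegree (Fin d) ℝ n := by
  refine restrictTotalDegree_induction (P := fun p =>
      jacobiOp a s p - (((n + 1 : ℕ) : ℝ) * ((n + 1 : ℕ) + s - 1)) • p
        ∈ MvPolynomial.restrictTotalDegree (Fin d) ℝ n)
    (fun α hα => ?_) ?_ (fun p q hp hq => ?_) (fun c p hp => ?_) hp
  · rcases hα.eq_or_lt with h | h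
    · simpa only [h] using jacobiOp_monomial_sub_mem a s α hα
    · have h2 : (MvPolynomial.monomial α (1 : ℝ))
          ∈ MvPolynomial.restrictTotalDegree (Fin d) ℝ n :=
        (MvPolynomial.mem_restrictTotalDegree _ _ _).2
          ((MvPolynomial.isHomogeneous_monomial (1 : ℝ) rfl).totalDegree_le.trans (by omega))
      exact Submodule.sub_mem _ (jacobiOp_mem a s h2) (Submodule.smul_mem _ _ h2)
  · simp [jacobiOp]
  · rw [jacobiOp_add, smul_add, add_sub_add_comm]; exact Submodule.add_mem _ hp hq
  · rw [jacobiOp_smul, smul_comm _ c, ← smul_sub]; exact Submodule.smul_mem _ _ hp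

/-- The bilinear gradient form `∑ x_i ∂_i f ∂_i g - ⟨x,∇f⟩⟨x,∇g⟩`. -/
def gradForm {d : ℕ} (f g : MvPolynomial (Fin d) ℝ) : MvPolynomial (Fin d) ℝ :=
  ∑ i, MvPolynomial.X i * MvPolynomial.pderiv i f * MvPolynomial.pderiv i g
    - eulerOp d f * eulerOp d g

theorem moment_identity {d : ℕ} (L : MvPolynomial (Fin d) ℝ →ₗ[ℝ] ℝ) (a : Fin d → ℝ) (s : ℝ)
    (hL : ∀ (α : Fin d →₀ ℕ) (i : Fin d),
      (α.degree + s) * L (MvPolynomial.X i * MvPolynomial.monomial α 1)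
        = (α i + a i) * L (MvPolynomial.monomial α 1))
    (i : Fin d) (h : MvPolynomial (Fin d) ℝ) :
    L (MvPolynomial.X i * (eulerOp d h + s • h))
      = L (MvPolynomial.X i * MvPolynomial.pderiv i h + a i • h) := by
  induction h using MvPolynomial.induction_on' with
  | monomial α c =>
    have e : MvPolynomial.monomial α c = c • MvPolynomial.monomial α (1 : ℝ) := by
      simp [MvPolynomial.smul_monomial]
    rw [MvPolynomial.X_mul_pderiv_monomial, eulerOp_monomial, ← add_smul,
      ← Nat.cast_smul_eq_nsmul ℝ, ← add_smul, e, mul_smul_comm, mul_smul_comm]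
    simp only [map_smul, smul_eq_mul]
    linear_combination c * hL α i
  | add p q hp hq =>
    simp only [map_add, smul_add, mul_add] at hp hq ⊢
    linarith

/-- Integration by parts: `gradForm` is the quadratic form of `jacobiOp`. -/
theorem apply_gradForm {d : ℕ} (L : MvPolynomial (Fin d) ℝ →ₗ[ℝ] ℝ) (a : Fin d → ℝ) (s : ℝ)
    (hL : ∀ (α : Fin d →₀ ℕ) (i : Fin d),
      (α.degree + s) * L (MvPolynomial.X i * MvPolynomial.monomial α 1)
        = (α i + a i) * L (MvPolynomial.monomial α 1))
    (f g : MvPolynomial (Fin d) ℝ) : L (gradForm f g) = L (g * jacobiOp a s f) := by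
  have key := fun i => moment_identity L a s hL i (g * MvPolynomial.pderiv i f)
  have key' := Finset.sum_congr (rfl : (Finset.univ : Finset (Fin d)) = _) fun i _ => key i
  rw [← map_sum, ← map_sum, ← sub_eq_zero, ← map_sub] at key'
  rw [← sub_eq_zero, ← map_sub, ← neg_eq_zero, ← map_neg, ← key']
  congr 1
  have hE : eulerOp d (eulerOp d f) = ∑ i, (MvPolynomial.X i * MvPolynomial.pderiv i f +
      MvPolynomial.X i * eulerOp d (MvPolynomial.pderiv i f)) := by
    conv_lhs => rw [eulerOp_apply f, map_sum]
    refine Finset.sum_congr rfl fun i _ => ?_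
    have : eulerOp d (MvPolynomial.X i) = MvPolynomial.X i := by
      have := eulerOp_monomial (Finsupp.single i 1) (1 : ℝ)
      simpa [MvPolynomial.X] using this
    rw [Derivation.leibniz, this, smul_eq_mul, smul_eq_mul]
    ring
  simp only [gradForm, jacobiOp, Derivation.leibniz, hE, smul_eq_mul]
  conv_lhs => rw [eulerOp_apply f]
  simp only [MvPolynomial.smul_eq_C_mul, mul_add, Finset.mul_sum, Finset.sum_mul,
    ← Finset.sum_add_distrib, sub_eq_add_neg, neg_add, ← Finset.sum_neg_distrib, neg_neg]
  refine Finset.sum_congr rfl fun i _ => ?_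
  simp only [map_add, map_neg, map_one]
  ring

theorem exists_projection {d : ℕ} (L : MvPolynomial (Fin d) ℝ →ₗ[ℝ] ℝ)
    (hpos : ∀ p, L (p * p) = 0 → p = 0) (n : ℕ) (f : MvPolynomial (Fin d) ℝ) :
    ∃ q ∈ MvPolynomial.restrictTotalDegree (Fin d) ℝ n,
      ∀ r ∈ MvPolynomial.restrictTotalDegree (Fin d) ℝ n, L ((f - q) * r) = 0 := by
  set W := MvPolynomial.restrictTotalDegree (Fin d) ℝ n with hW
  let B : MvPolynomial (Fin d) ℝ →ₗ[ℝ] Module.Dual ℝ W :=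
    ((LinearMap.mul ℝ (MvPolynomial (Fin d) ℝ)).compr₂ L).compl₂ W.subtype
  have hB : ∀ p (r : W), B p r = L (p * r) := fun p r => rfl
  have hinj : Function.Injective (B ∘ₗ W.subtype) := by
    rw [injective_iff_map_eq_zero]
    intro q hq
    have := congrArg (fun φ : Module.Dual ℝ W => φ q) hq
    exact Subtype.ext (hpos q this)
  have hsurj := (LinearMap.injective_iff_surjective_of_finrank_eq_finrank
    (Subspace.dual_finrank_eq (K := ℝ) (V := W)).symm).1 hinj
  obtain ⟨q, hq⟩ := hsurj (B f)
  refine ⟨q, q.2, fun r hr => ?_⟩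
  have := congrArg (fun φ : Module.Dual ℝ W => φ ⟨r, hr⟩) hq
  simp only [LinearMap.comp_apply, hB, Submodule.subtype_apply] at this
  rw [sub_mul, map_sub, this, sub_self]

theorem gradForm_comm {d : ℕ} (f g : MvPolynomial (Fin d) ℝ) : gradForm f g = gradForm g f := by
  simp only [gradForm, mul_comm (eulerOp d f), mul_right_comm]

theorem gradForm_add_self {d : ℕ} (f g : MvPolynomial (Fin d) ℝ) :
    gradForm (f + g) (f + g) = gradForm f f + 2 * gradForm f g + gradForm g g := by
  simp only [gradForm, map_add, mul_add, add_mul, mul_sub, Finset.sum_add_distrib, Finset.mul_sum]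
  have : ∀ i : Fin d, MvPolynomial.X i * MvPolynomial.pderiv i g * MvPolynomial.pderiv i f
    = MvPolynomial.X i * MvPolynomial.pderiv i f * MvPolynomial.pderiv i g := fun i => by ring
  simp only [this, two_mul, Finset.sum_add_distrib]
  ring

theorem apply_gradForm_self_le {d : ℕ} (L : MvPolynomial (Fin d) ℝ →ₗ[ℝ] ℝ) (a : Fin d → ℝ)
    (s : ℝ) (hs : 0 < s) (hnn : ∀ p, 0 ≤ L (p * p)) (hpos : ∀ p, L (p * p) = 0 → p = 0)
    (hL : ∀ (α : Fin d →₀ ℕ) (i : Fin d),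
      (α.degree + s) * L (MvPolynomial.X i * MvPolynomial.monomial α 1)
        = (α i + a i) * L (MvPolynomial.monomial α 1))
    (n : ℕ) (f : MvPolynomial (Fin d) ℝ) (hf : f.totalDegree ≤ n) :
    L (gradForm f f) ≤ (n : ℝ) * (n + s - 1) * L (f * f) := by
  induction n generalizing f with
  | zero =>
    rw [MvPolynomial.totalDegree_eq_zero_iff_eq_C.1 (Nat.le_zero.1 hf)]
    simp [gradForm]
  | succ n ih =>
    obtain ⟨q, hq, hqr⟩ := exists_projection L hpos n f
    have hf' := (MvPolynomial.mem_restrictTotalDegree (R := ℝ) (Fin d) (n + 1) f).2 hf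
    have hq' := (MvPolynomial.mem_restrictTotalDegree (R := ℝ) (Fin d) n q).1 hq
    have hp : f - q ∈ MvPolynomial.restrictTotalDegree (Fin d) ℝ (n + 1) :=
      Submodule.sub_mem _ hf' ((MvPolynomial.mem_restrictTotalDegree _ _ _).2 (by omega))
    set p := f - q with hpdef
    have hfpq : f = p + q := by simp [hpdef]
    have hpq : L (gradForm p q) = 0 := by
      rw [gradForm_comm, apply_gradForm L a s hL]
      exact hqr _ (jacobiOp_mem a s hq)
    have hpp : L (gradForm p p) = ((n + 1 : ℕ) : ℝ) * ((n + 1 : ℕ) + s - 1) * L (p * p) := by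
      have h := hqr _ (jacobiOp_sub_mem a s hp)
      rw [mul_sub, map_sub, mul_smul_comm, map_smul, smul_eq_mul, sub_eq_zero] at h
      rw [apply_gradForm L a s hL, h]
    have hff : L (f * f) = L (p * p) + L (q * q) := by
      have h := hqr q hq
      have e : f * f = p * p + (p * q + p * q) + q * q := by rw [hfpq]; ring
      simp [e, h]
    have hT : L (gradForm f f) = L (gradForm p p) + L (gradForm q q) := by
      rw [hfpq, gradForm_add_self, two_mul]
      simp [hpq]
    rw [hT, hpp, hff, mul_add]
    gcongr
    refine (ih q hq').trans (mul_le_mul_of_nonneg_right ?_ (hnn q))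
    push_cast
    nlinarith [(Nat.cast_nonneg n : (0 : ℝ) ≤ n)]

theorem sum_add_pos {d : ℕ} {κ : Fin (d + 1) → ℝ} (hκ : ∀ i, -1 < κ i) :
    0 < (∑ i, κ i) + d + 1 := by
  have : 0 < ∑ i, (κ i + 1) :=
    Finset.sum_pos (fun i _ => by linarith [hκ i]) Finset.univ_nonempty
  simp [Finset.sum_add_distrib] at this
  linarith

/-- The truncated power `t_+^a`, with values in `[0, ∞]`. -/
def truncPow (a t : ℝ) : ENNReal := if 0 < t then ENNReal.ofReal (t ^ a) else 0

@[fun_prop]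
theorem measurable_truncPow (a : ℝ) : Measurable (truncPow a) :=
  Measurable.ite measurableSet_Ioi (by fun_prop) measurable_const

theorem lintegral_eq_mul_lintegral_comp_mul {s : ℝ} (hs : 0 < s) {g : ℝ → ENNReal}
    (hg : Measurable g) : ∫⁻ t, g t = ENNReal.ofReal s * ∫⁻ u, g (s * u) := by
  conv_lhs => rw [← Real.smul_map_volume_mul_left hs.ne']
  rw [lintegral_smul_measure, lintegral_map hg (by fun_prop), abs_of_pos hs, smul_eq_mul]

theorem lintegral_truncPow_conv {a c : ℝ} (ha : -1 < a) (hc : -1 < c) (s : ℝ) :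
    ∫⁻ t, truncPow a t * truncPow c (s - t) =
      ENNReal.ofReal (Real.Gamma (a + 1) * Real.Gamma (c + 1) / Real.Gamma (a + c + 2))
        * truncPow (a + c + 1) s := by
  rcases le_or_gt s 0 with hs | hs
  · have h0 : truncPow (a + c + 1) s = 0 := if_neg hs.not_gt
    rw [h0, mul_zero, lintegral_eq_zero_iff (by fun_prop)]
    refine Filter.Eventually.of_forall fun t => ?_
    rcases le_or_gt t 0 with ht | ht
    · simp [truncPow, ht.not_gt]
    · simp [truncPow, (by linarith : ¬ t < s)]
  · have ha' : 0 < a + 1 := by linarith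
    have hc' : 0 < c + 1 := by linarith
    have hb := ProbabilityTheory.beta_pos ha' hc'
    have hbeta : ProbabilityTheory.beta (a + 1) (c + 1) =
        Real.Gamma (a + 1) * Real.Gamma (c + 1) / Real.Gamma (a + c + 2) := by
      rw [ProbabilityTheory.beta]; congr 2; ring
    rw [← hbeta]
    set b := ProbabilityTheory.beta (a + 1) (c + 1) with hbdef
    have key : ∀ u, truncPow a (s * u) * truncPow c (s - s * u) =
        ENNReal.ofReal (s ^ (a + c) * b) * ProbabilityTheory.betaPDF (a + 1) (c + 1) u := by
      intro u
      rw [ProbabilityTheory.betaPDF_eq, ← hbdef]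
      have e : s - s * u = s * (1 - u) := by ring
      by_cases hu : 0 < u ∧ u < 1
      · have h1 : 0 < 1 - u := by linarith [hu.2]
        rw [if_pos hu, e, truncPow, truncPow, if_pos (mul_pos hs hu.1), if_pos (mul_pos hs h1),
          ← ENNReal.ofReal_mul (by have := mul_pos hs hu.1; positivity),
          ← ENNReal.ofReal_mul (by positivity), Real.mul_rpow hs.le hu.1.le,
          Real.mul_rpow hs.le h1.le, Real.rpow_add hs, add_sub_cancel_right, add_sub_cancel_right]
        congr 1
        field_simp
      · rw [if_neg hu, ENNReal.ofReal_zero, mul_zero, e, truncPow, truncPow]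
        rw [not_and_or] at hu
        rcases hu with hu | hu
        · simp [hu, mul_pos_iff_of_pos_left hs]
        · simp [hu, mul_pos_iff_of_pos_left hs]
    rw [lintegral_eq_mul_lintegral_comp_mul hs (by fun_prop)]
    simp_rw [key]
    rw [lintegral_const_mul' _ _ ENNReal.ofReal_ne_top,
      ProbabilityTheory.lintegral_betaPDF_eq_one ha' hc', mul_one, truncPow, if_pos hs,
      ← ENNReal.ofReal_mul hs.le, ← ENNReal.ofReal_mul hb.le]
    congr 1
    rw [Real.rpow_add_one hs.ne']
    ring

/-- The Dirichlet integral over the simplex of size `s`. -/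
theorem lintegral_dirichlet {d : ℕ} (a : Fin d → ℝ) (ha : ∀ i, -1 < a i) {c : ℝ} (hc : -1 < c)
    (s : ℝ) :
    ∫⁻ x : Fin d → ℝ, (∏ i, truncPow (a i) (x i)) * truncPow c (s - ∑ i, x i) =
      ENNReal.ofReal ((∏ i, Real.Gamma (a i + 1)) * Real.Gamma (c + 1) /
        Real.Gamma (∑ i, a i + d + c + 1)) * truncPow (∑ i, a i + d + c) s := by
  induction d generalizing s with
  | zero =>
    have hG := (Real.Gamma_pos_of_pos (by linarith : 0 < c + 1)).ne'
    simp [hG, lintegral_unique, volume_pi]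
  | succ d ih =>
    have hm : Measurable fun x : Fin (d + 1) → ℝ =>
        (∏ i, truncPow (a i) (x i)) * truncPow c (s - ∑ i, x i) := by fun_prop
    rw [← ((volume_preserving_piFinSuccAbove (fun _ : Fin (d + 1) => ℝ) 0).symm).lintegral_comp hm,
      Measure.volume_eq_prod,
      lintegral_prod _ (by fun_prop)]
    have hsum : -1 < ∑ i : Fin d, a i.succ + d + c := by
      have : 0 ≤ ∑ i : Fin d, (a i.succ + 1) := Finset.sum_nonneg fun i _ => by linarith [ha i.succ]
      simp [Finset.sum_add_distrib] at this
      linarith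
    have key : ∀ t : ℝ, ∫⁻ y : Fin d → ℝ,
        (∏ i, truncPow (a i) ((MeasurableEquiv.piFinSuccAbove (fun _ => ℝ) 0).symm (t, y) i)) *
          truncPow c (s - ∑ i, (MeasurableEquiv.piFinSuccAbove (fun _ => ℝ) 0).symm (t, y) i) =
        ENNReal.ofReal ((∏ i : Fin d, Real.Gamma (a i.succ + 1)) * Real.Gamma (c + 1) /
          Real.Gamma (∑ i : Fin d, a i.succ + d + c + 1)) *
          (truncPow (a 0) t * truncPow (∑ i : Fin d, a i.succ + d + c) (s - t)) := by
      intro t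
      rw [mul_left_comm, ← ih (fun i => a i.succ) (fun i => ha i.succ) (s - t),
        ← lintegral_const_mul _ (by fun_prop)]
      refine lintegral_congr fun y => ?_
      simp [Fin.prod_univ_succ, Fin.sum_univ_succ, mul_assoc, sub_sub]
    simp_rw [key]
    rw [lintegral_const_mul _ (by fun_prop), lintegral_truncPow_conv (ha 0) hsum, ← mul_assoc,
      ← ENNReal.ofReal_mul]
    · have hG := (Real.Gamma_pos_of_pos (by linarith : 0 < ∑ i : Fin d, a i.succ + d + c + 1)).ne'
      congr 2
      · rw [Fin.prod_univ_succ, Fin.sum_univ_succ]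
        have e : a 0 + (∑ i : Fin d, a i.succ + d + c) + 2 =
            a 0 + ∑ i : Fin d, a i.succ + ((d + 1 : ℕ) : ℝ) + c + 1 := by push_cast; ring
        rw [e]
        field_simp
      · rw [Fin.sum_univ_succ]; push_cast; ring
    · have := fun i : Fin d => Real.Gamma_pos_of_pos (by linarith [ha i.succ] : 0 < a i.succ + 1)
      have h1 := Real.Gamma_pos_of_pos (by linarith : 0 < ∑ i : Fin d, a i.succ + d + c + 1)
      have h2 := Real.Gamma_pos_of_pos (by linarith : 0 < c + 1)
      have h3 := Finset.prod_pos fun i (_ : i ∈ Finset.univ) => this i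
      positivity

/-- The open simplex. -/
def openSplx (d : ℕ) : Set (Fin d → ℝ) := {x | (∀ i, 0 < x i) ∧ ∑ i, x i < 1}

theorem isOpen_openSplx (d : ℕ) : IsOpen (openSplx d) := by
  have : openSplx d = (⋂ i, {x : Fin d → ℝ | 0 < x i}) ∩ {x | ∑ i, x i < 1} := by
    ext x; simp [openSplx]
  rw [this]
  exact (isOpen_iInter_of_finite fun i => isOpen_lt continuous_const (continuous_apply i)).inter
    (isOpen_lt (by fun_prop) continuous_const)

theorem volume_sum_eq_one (d : ℕ) : volume {x : Fin d → ℝ | ∑ i, x i = 1} = 0 := by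
  let φ : (Fin d → ℝ) →ₗ[ℝ] ℝ := ∑ i, LinearMap.proj i
  let S : AffineSubspace ℝ (Fin d → ℝ) := (affineSpan ℝ {(1 : ℝ)}).comap φ.toAffineMap
  have hmem : ∀ x, x ∈ S ↔ ∑ i, x i = 1 := fun x => by
    simp [S, φ, AffineSubspace.mem_comap]
  have hS : S ≠ ⊤ := by
    intro h
    have : (0 : Fin d → ℝ) ∈ S := h ▸ AffineSubspace.mem_top ..
    simp [hmem] at this
  have e : {x : Fin d → ℝ | ∑ i, x i = 1} = S := by ext x; simp [hmem]
  rw [e]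
  exact Measure.addHaar_affineSubspace _ _ hS

theorem openSplx_ae_eq (d : ℕ) : (openSplx d : Set (Fin d → ℝ)) =ᵐ[volume] Splx d := by
  have h1 : ∀ᵐ x : Fin d → ℝ, ∑ i, x i ≠ 1 := by
    rw [ae_iff]; simpa using volume_sum_eq_one d
  have h2 : ∀ᵐ x : Fin d → ℝ, ∀ i, x i ≠ 0 := by
    rw [ae_all_iff]
    intro i
    rw [ae_iff, volume_pi]
    simpa using Measure.pi_hyperplane (fun _ : Fin d => (volume : Measure ℝ)) i 0
  filter_upwards [h1, h2] with x hx1 hx2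
  refine propext ⟨fun h => ⟨fun i => (h.1 i).le, h.2.le⟩,
    fun h => ⟨fun i => lt_of_le_of_ne (h.1 i) (hx2 i).symm, lt_of_le_of_ne h.2 hx1⟩⟩

theorem measurable_Wk {d : ℕ} (κ : Fin (d + 1) → ℝ) : Measurable (Wk κ) := by
  unfold Wk; fun_prop

theorem measurable_eval {d : ℕ} (p : MvPolynomial (Fin d) ℝ) :
    Measurable fun x => MvPolynomial.eval x p :=
  (MvPolynomial.continuous_eval p).measurable

theorem lintegral_monomial_mul_Wk {d : ℕ} {κ : Fin (d + 1) → ℝ} (hκ : ∀ i, -1 < κ i)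
    (α : Fin d →₀ ℕ) :
    ∫⁻ x in openSplx d, ENNReal.ofReal (MvPolynomial.eval x (MvPolynomial.monomial α 1) * Wk κ x)
      = ENNReal.ofReal ((∏ i, Real.Gamma (α i + κ i.castSucc + 1)) *
        Real.Gamma (κ (Fin.last d) + 1) / Real.Gamma (α.degree + (∑ i, κ i) + d + 1)) := by
  have h := lintegral_dirichlet (fun i => α i + κ i.castSucc)
    (fun i => by have := hκ i.castSucc; have : (0 : ℝ) ≤ α i := Nat.cast_nonneg _; linarith)
    (hκ (Fin.last d)) 1
  rw [← lintegral_indicator (isOpen_openSplx d).measurableSet]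
  have e : (α.degree + (∑ i, κ i) + d + 1 : ℝ) =
      ∑ i, (α i + κ i.castSucc) + d + κ (Fin.last d) + 1 := by
    rw [Fin.sum_univ_castSucc, Finset.sum_add_distrib, Finsupp.degree_eq_sum]
    push_cast
    ring
  rw [e]
  convert h using 1
  · refine lintegral_congr fun x => ?_
    by_cases hx : x ∈ openSplx d
    · rw [Set.indicator_of_mem hx]
      have hp := hx.1
      have hl : 0 < 1 - ∑ i, x i := by linarith [hx.2]
      rw [truncPow, if_pos hl]
      have : ∀ i, truncPow (α i + κ i.castSucc) (x i) =
          ENNReal.ofReal (x i ^ (α i) * x i ^ κ i.castSucc) := fun i => by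
        rw [truncPow, if_pos (hp i), Real.rpow_add (hp i), Real.rpow_natCast]
      simp_rw [this]
      rw [← ENNReal.ofReal_prod_of_nonneg (fun i _ => by have := hp i; positivity),
        ← ENNReal.ofReal_mul (Finset.prod_nonneg fun i _ => by have := hp i; positivity)]
      congr 1
      rw [MvPolynomial.eval_monomial, Finsupp.prod_fintype _ _ (by simp), Wk,
        Finset.prod_mul_distrib]
      ring
    · rw [Set.indicator_of_notMem hx]
      symm
      rw [mul_eq_zero]
      by_cases h1 : ∀ i, 0 < x i
      · right
        exact if_neg fun h2 => hx ⟨h1, by linarith⟩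
      · left
        push Not at h1
        obtain ⟨i, hi⟩ := h1
        exact Finset.prod_eq_zero (Finset.mem_univ i) (if_neg hi.not_gt)
  · simp [truncPow]

theorem Wk_pos {d : ℕ} (κ : Fin (d + 1) → ℝ) {x : Fin d → ℝ} (hx : x ∈ openSplx d) :
    0 < Wk κ x :=
  mul_pos (Finset.prod_pos fun i _ => Real.rpow_pos_of_pos (hx.1 i) _)
    (Real.rpow_pos_of_pos (by linarith [hx.2]) _)

theorem monomial_mul_Wk_nonneg {d : ℕ} (κ : Fin (d + 1) → ℝ) (α : Fin d →₀ ℕ) :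
    0 ≤ᵐ[volume.restrict (openSplx d)]
      fun x => MvPolynomial.eval x (MvPolynomial.monomial α 1) * Wk κ x := by
  refine ae_restrict_of_forall_mem (isOpen_openSplx d).measurableSet fun x hx => ?_
  refine mul_nonneg ?_ (Wk_pos κ hx).le
  rw [MvPolynomial.eval_monomial, one_mul]
  exact Finset.prod_nonneg fun i _ => pow_nonneg (hx.1 i).le _

theorem integrableOn_eval_mul_Wk {d : ℕ} {κ : Fin (d + 1) → ℝ} (hκ : ∀ i, -1 < κ i)
    (p : MvPolynomial (Fin d) ℝ) :
    IntegrableOn (fun x => MvPolynomial.eval x p * Wk κ x) (openSplx d) := by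
  induction p using MvPolynomial.induction_on' with
  | monomial α c =>
    have h : IntegrableOn (fun x => MvPolynomial.eval x (MvPolynomial.monomial α 1) * Wk κ x)
        (openSplx d) := by
      refine ⟨((measurable_eval _).mul (measurable_Wk κ)).aestronglyMeasurable, ?_⟩
      rw [hasFiniteIntegral_iff_ofReal (monomial_mul_Wk_nonneg κ α), lintegral_monomial_mul_Wk hκ]
      exact ENNReal.ofReal_lt_top
    have e : MvPolynomial.monomial α c = c • MvPolynomial.monomial α (1 : ℝ) := by
      simp [MvPolynomial.smul_monomial]
    simpa only [IntegrableOn, e, MvPolynomial.smul_eval, mul_assoc] using Integrable.const_mul h c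
  | add p q hp hq =>
    simp only [map_add, add_mul]
    exact Integrable.add hp hq

/-- The functional `p ↦ ∫ p W_κ` over the simplex. -/
def jacobiFunctional {d : ℕ} {κ : Fin (d + 1) → ℝ} (hκ : ∀ i, -1 < κ i) :
    MvPolynomial (Fin d) ℝ →ₗ[ℝ] ℝ where
  toFun p := ∫ x in openSplx d, MvPolynomial.eval x p * Wk κ x
  map_add' p q := by
    simp only [map_add, add_mul]
    exact integral_add (integrableOn_eval_mul_Wk hκ p) (integrableOn_eval_mul_Wk hκ q)
  map_smul' c p := by
    simp only [MvPolynomial.smul_eval, mul_assoc, integral_const_mul, RingHom.id_apply,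
      smul_eq_mul]

theorem jacobiFunctional_monomial {d : ℕ} {κ : Fin (d + 1) → ℝ} (hκ : ∀ i, -1 < κ i)
    (α : Fin d →₀ ℕ) :
    jacobiFunctional hκ (MvPolynomial.monomial α 1) =
      (∏ i, Real.Gamma (α i + κ i.castSucc + 1)) *
        Real.Gamma (κ (Fin.last d) + 1) / Real.Gamma (α.degree + (∑ i, κ i) + d + 1) := by
  have hs := sum_add_pos hκ
  change ∫ x in openSplx d, _ = _
  rw [integral_eq_lintegral_of_nonneg_ae (monomial_mul_Wk_nonneg κ α)
    ((measurable_eval _).mul (measurable_Wk κ)).aestronglyMeasurable,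
    lintegral_monomial_mul_Wk hκ, ENNReal.toReal_ofReal]
  have h1 := Real.Gamma_pos_of_pos (by linarith [hκ (Fin.last d)] : 0 < κ (Fin.last d) + 1)
  have h2 := Real.Gamma_pos_of_pos (by positivity : 0 < α.degree + ((∑ i, κ i) + d + 1))
  rw [← add_assoc, ← add_assoc] at h2
  have h3 : 0 < ∏ i, Real.Gamma (α i + κ i.castSucc + 1) := Finset.prod_pos fun i _ =>
    Real.Gamma_pos_of_pos (by
      have := hκ i.castSucc; have : (0 : ℝ) ≤ α i := Nat.cast_nonneg _; linarith)
  positivity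

theorem jacobiFunctional_X_mul_monomial {d : ℕ} {κ : Fin (d + 1) → ℝ} (hκ : ∀ i, -1 < κ i)
    (α : Fin d →₀ ℕ) (i : Fin d) :
    (α.degree + ((∑ i, κ i) + d + 1)) *
        jacobiFunctional hκ (MvPolynomial.X i * MvPolynomial.monomial α 1)
      = (α i + (κ i.castSucc + 1)) * jacobiFunctional hκ (MvPolynomial.monomial α 1) := by
  have hs := sum_add_pos hκ
  have hs' : (0 : ℝ) < α.degree + (∑ i, κ i) + d + 1 := by
    have : (0 : ℝ) ≤ α.degree := Nat.cast_nonneg _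
    linarith
  have hi : (0 : ℝ) < α i + κ i.castSucc + 1 := by
    have := hκ i.castSucc; have : (0 : ℝ) ≤ α i := Nat.cast_nonneg _; linarith
  have e : MvPolynomial.X i * MvPolynomial.monomial α (1 : ℝ) =
      MvPolynomial.monomial (α + Finsupp.single i 1) 1 := by
    rw [MvPolynomial.X, MvPolynomial.monomial_mul, add_comm, one_mul]
  rw [e, jacobiFunctional_monomial, jacobiFunctional_monomial,
    ← Finset.mul_prod_erase _ _ (Finset.mem_univ i),
    ← Finset.mul_prod_erase _ (fun j => Real.Gamma (α j + κ j.castSucc + 1))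
      (Finset.mem_univ i)]
  have hprod : ∏ j ∈ Finset.univ.erase i,
      Real.Gamma (((α + Finsupp.single i 1 : Fin d →₀ ℕ) j : ℕ) + κ j.castSucc + 1) =
      ∏ j ∈ Finset.univ.erase i, Real.Gamma (α j + κ j.castSucc + 1) := by
    refine Finset.prod_congr rfl fun j hj => ?_
    simp [Finsupp.single_eq_of_ne (Finset.ne_of_mem_erase hj)]
  have hg1 : (((α + Finsupp.single i 1 : Fin d →₀ ℕ) i : ℕ) + κ i.castSucc + 1 : ℝ) =
      (α i + κ i.castSucc + 1) + 1 := by simp; ring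
  have hg2 : ((α + Finsupp.single i 1).degree + (∑ i, κ i) + d + 1 : ℝ) =
      (α.degree + (∑ i, κ i) + d + 1) + 1 := by simp; ring
  have hG := Real.Gamma_pos_of_pos hs'
  rw [hprod, hg1, hg2, Real.Gamma_add_one hi.ne', Real.Gamma_add_one hs'.ne']
  have hs'' := hs'.ne'
  field_simp
  ring

theorem jacobiFunctional_mul_self_nonneg {d : ℕ} {κ : Fin (d + 1) → ℝ} (hκ : ∀ i, -1 < κ i)
    (p : MvPolynomial (Fin d) ℝ) : 0 ≤ jacobiFunctional hκ (p * p) := by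
  refine setIntegral_nonneg (isOpen_openSplx d).measurableSet fun x hx => ?_
  rw [map_mul]
  exact mul_nonneg (mul_self_nonneg _) (Wk_pos κ hx).le

theorem eq_zero_of_jacobiFunctional_mul_self {d : ℕ} {κ : Fin (d + 1) → ℝ} (hκ : ∀ i, -1 < κ i)
    (p : MvPolynomial (Fin d) ℝ) (hp : jacobiFunctional hκ (p * p) = 0) : p = 0 := by
  have hm := (isOpen_openSplx d).measurableSet
  have hnn : 0 ≤ᵐ[volume.restrict (openSplx d)]
      fun x => MvPolynomial.eval x (p * p) * Wk κ x := by
    refine ae_restrict_of_forall_mem hm fun x hx => ?_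
    simp only [map_mul]
    exact mul_nonneg (mul_self_nonneg _) (Wk_pos κ hx).le
  have h0 := (setIntegral_eq_zero_iff_of_nonneg_ae hnn (integrableOn_eval_mul_Wk hκ _)).1 hp
  have h1 : (fun x => MvPolynomial.eval x p) =ᵐ[volume.restrict (openSplx d)] fun _ => 0 := by
    filter_upwards [h0, ae_restrict_mem hm] with x hx hxm
    simpa [(Wk_pos κ hxm).ne'] using hx
  have h2 := Measure.eqOn_open_of_ae_eq h1 (isOpen_openSplx d)
    (MvPolynomial.continuous_eval p).continuousOn continuousOn_const
  have hd : (0 : ℝ) < 1 / (d + 1) := by positivity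
  refine MvPolynomial.funext_set (fun _ => Set.Ioo 0 (1 / (d + 1) : ℝ))
    (fun _ => Set.Ioo_infinite hd) fun x hx => ?_
  rw [map_zero]
  refine h2 ⟨fun i => (hx i trivial).1, ?_⟩
  calc ∑ i, x i ≤ ∑ _i : Fin d, (1 / (d + 1) : ℝ) :=
        Finset.sum_le_sum fun i _ => (hx i trivial).2.le
    _ = d / (d + 1) := by simp [div_eq_mul_inv]
    _ < 1 := by rw [div_lt_one (by positivity)]; linarith

theorem differentiable_eval {d : ℕ} (p : MvPolynomial (Fin d) ℝ) :
    Differentiable ℝ fun x => MvPolynomial.eval x p := by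
  induction p using MvPolynomial.induction_on with
  | C a => simp
  | add p q hp hq => simpa only [map_add] using hp.fun_add hq
  | mul_X p i hp =>
    simp only [map_mul, MvPolynomial.eval_X]
    fun_prop

theorem pd_eval {d : ℕ} (i : Fin d) (p : MvPolynomial (Fin d) ℝ) (x : Fin d → ℝ) :
    pd i (fun x => MvPolynomial.eval x p) x = MvPolynomial.eval x (MvPolynomial.pderiv i p) := by
  rw [pd]
  induction p using MvPolynomial.induction_on with
  | C a => simp
  | add p q hp hq =>
    simp only [map_add]
    rw [fderiv_fun_add (differentiable_eval p x) (differentiable_eval q x)]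
    simp [hp, hq]
  | mul_X p j hp =>
    simp only [map_mul, MvPolynomial.eval_X]
    have hx : HasFDerivAt (fun x : Fin d → ℝ => x j) (ContinuousLinearMap.proj (R := ℝ) j) x :=
      hasFDerivAt_apply j x
    rw [((differentiable_eval p x).hasFDerivAt.fun_mul hx).fderiv]
    simp [hp, MvPolynomial.pderiv_X, Pi.single_apply]
    by_cases hij : i = j
    · simp [hij]
    · simp [Ne.symm hij]

theorem bk_pos {d : ℕ} {κ : Fin (d + 1) → ℝ} (hκ : ∀ i, -1 < κ i) : 0 < bk κ :=
  div_pos (Real.Gamma_pos_of_pos (sum_add_pos hκ))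
    (Finset.prod_pos fun i _ => Real.Gamma_pos_of_pos (by linarith [hκ i]))

theorem nrm2_sq_eq {d : ℕ} {κ : Fin (d + 1) → ℝ} (hκ : ∀ i, -1 < κ i)
    {F : (Fin d → ℝ) → ℝ} (H G : MvPolynomial (Fin d) ℝ)
    (hH : ∀ x ∈ openSplx d, 0 ≤ MvPolynomial.eval x H)
    (hF : ∀ x, F x = Real.sqrt (MvPolynomial.eval x H) * MvPolynomial.eval x G) :
    nrm2 κ F ^ 2 = bk κ * jacobiFunctional hκ (H * (G * G)) := by
  have hm := (isOpen_openSplx d).measurableSet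
  have e : ipk κ F F = bk κ * jacobiFunctional hκ (H * (G * G)) := by
    rw [ipk, ← setIntegral_congr_set (openSplx_ae_eq d)]
    congr 1
    refine setIntegral_congr_fun hm fun x hx => ?_
    simp only [hF, map_mul]
    rw [mul_mul_mul_comm, Real.mul_self_sqrt (hH x hx)]
  rw [nrm2, Real.sq_sqrt, e]
  rw [e]
  refine mul_nonneg (bk_pos hκ).le (setIntegral_nonneg hm fun x hx => ?_)
  rw [map_mul, map_mul]
  exact mul_nonneg (mul_nonneg (hH x hx) (mul_self_nonneg _)) (Wk_pos κ hx).le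

theorem sum_sum_sq_sub_eq {d : ℕ} {R : Type*} [CommRing R] (x g : Fin d → R) :
    ∑ i, x i * (1 - ∑ k, x k) * (g i * g i) +
        ∑ i, ∑ j ∈ Finset.univ.filter (fun j => i < j), x i * x j * ((g i - g j) * (g i - g j)) =
      ∑ i, x i * g i * g i - (∑ i, x i * g i) * ∑ i, x i * g i := by
  have h := Finset.sum_sum_Ioi_add_eq_sum_sum_off_diag
    (fun i j : Fin d => x i * x j * (g i * g i - g i * g j))
  have h1 : ∑ i, ∑ j ∈ Finset.univ.filter (fun j => i < j),
      x i * x j * ((g i - g j) * (g i - g j)) =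
      ∑ i, ∑ j, x j * x i * (g j * g j - g j * g i) := by
    have h2 : ∀ i : Fin d, ∑ j, x j * x i * (g j * g j - g j * g i) =
        ∑ j ∈ ({i}ᶜ : Finset (Fin d)), x j * x i * (g j * g j - g j * g i) := fun i => by
      rw [← Finset.sum_compl_add_sum {i}]
      simp
    simp_rw [h2]
    rw [← h]
    refine Finset.sum_congr rfl fun i _ => Finset.sum_congr ?_ fun j _ => by ring
    ext j; simp
  have h3 : ∑ i, ∑ j, x j * x i * (g j * g j - g j * g i) =
      (∑ i, x i) * (∑ j, x j * g j * g j) - (∑ i, x i * g i) * ∑ j, x j * g j := by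
    rw [Finset.sum_mul_sum, Finset.sum_mul_sum, ← Finset.sum_sub_distrib]
    refine Finset.sum_congr rfl fun i _ => ?_
    rw [← Finset.sum_sub_distrib]
    exact Finset.sum_congr rfl fun j _ => by ring
  have h4 : ∑ i, x i * (1 - ∑ k, x k) * (g i * g i) =
      (1 - ∑ k, x k) * ∑ i, x i * g i * g i := by
    rw [Finset.mul_sum]
    exact Finset.sum_congr rfl fun i _ => by ring
  rw [h1, h3, h4]
  ring

theorem bform_eq {d : ℕ} {κ : Fin (d + 1) → ℝ} (hκ : ∀ i, -1 < κ i)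
    (f : MvPolynomial (Fin d) ℝ) :
    bform κ (fun x => MvPolynomial.eval x f) = bk κ * jacobiFunctional hκ (gradForm f f) := by
  have h1 : ∀ i, nrm2 κ (fun x => Real.sqrt (x i * (1 - ∑ k, x k)) *
      pd i (fun x => MvPolynomial.eval x f) x) ^ 2 =
      bk κ * jacobiFunctional hκ (MvPolynomial.X i * (1 - ∑ k, MvPolynomial.X k) *
        (MvPolynomial.pderiv i f * MvPolynomial.pderiv i f)) := fun i => by
    refine nrm2_sq_eq hκ _ _ (fun x hx => ?_) fun x => by simp [pd_eval]
    simpa using mul_nonneg (hx.1 i).le (sub_nonneg.2 hx.2.le)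
  have h2 : ∀ i j, nrm2 κ (fun x => Real.sqrt (x i * x j) *
      pdd i j (fun x => MvPolynomial.eval x f) x) ^ 2 =
      bk κ * jacobiFunctional hκ (MvPolynomial.X i * MvPolynomial.X j *
        ((MvPolynomial.pderiv i f - MvPolynomial.pderiv j f) *
          (MvPolynomial.pderiv i f - MvPolynomial.pderiv j f))) := fun i j => by
    refine nrm2_sq_eq hκ _ _ (fun x hx => ?_) fun x => by simp [pdd, pd_eval]
    simpa using mul_nonneg (hx.1 i).le (hx.1 j).le
  rw [bform]
  simp_rw [h1, h2]
  simp_rw [← Finset.mul_sum, ← map_sum]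
  rw [← mul_add, ← map_add, sum_sum_sq_sub_eq, gradForm, eulerOp_apply]

/-- the sharp `L²` Bernstein inequality \eqref{eq:B-ineq0}. -/
theorem stmt3 (d : ℕ) (hd : 2 ≤ d) (κ : Fin (d+1) → ℝ) (hκ : ∀ i, -1 < κ i)
    (n : ℕ) (f : MvPolynomial (Fin d) ℝ) (hf : f.totalDegree ≤ n) :
    bform κ (fun x => MvPolynomial.eval x f) ≤
      (n : ℝ) * ((n : ℝ) + (∑ k, κ k) + (d : ℝ)) *
        nrm2 κ (fun x => MvPolynomial.eval x f) ^ 2 := by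
  have hff := nrm2_sq_eq hκ (F := fun x => MvPolynomial.eval x f) 1 f (by simp) (by simp)
  rw [one_mul] at hff
  rw [bform_eq hκ, hff, mul_left_comm]
  refine mul_le_mul_of_nonneg_left ?_ (bk_pos hκ).le
  have h := apply_gradForm_self_le (jacobiFunctional hκ) (fun i => κ i.castSucc + 1)
    ((∑ i, κ i) + d + 1) (sum_add_pos hκ) (jacobiFunctional_mul_self_nonneg hκ)
    (eq_zero_of_jacobiFunctional_mul_self hκ) (jacobiFunctional_X_mul_monomial hκ) n f hf
  have e : (n : ℝ) + ((∑ i, κ i) + d + 1) - 1 = n + (∑ i, κ i) + d := by ring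
  rwa [e] at h
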